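/- arXiv:2002.10924 — 3 statements merged into one kernel-verified Lean document; each statement's English description precedes it below -/
import Mathlib

section
/- Let u : Θ → V and ψ : Θ → V be differentiable, where A(u(θ), v; θ) = F(v; θ) for all v ∈ V and A(w, ψ(θ); θ) = (y − O(u(θ)))ᵀ Γ⁻¹ O(w) for all w ∈ V, at every θ ∈ Θ. Then for every θ ∈ Θ, ∑_{j=1}^d ‖∂_{θ_j} ψ(θ)‖_V ≤ (C_ψ(θ)/α(θ)) ∑_{j=1}^d ρ_j(θ) + d C_y/α(θ) + (C_O/α(θ)) ∑_{j=1}^d ‖∂_{θ_j} u(θ)‖_V, where C_u(θ) := ‖F(·;θ)‖_{V'}/α(θ) and C_ψ(θ) := C_y/α(θ) + (C_O/α(θ)) C_u(θ). -/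
open scoped RealInnerProductSpace

/-- The continuous linear map on Euclidean space associated with a square matrix;
its operator norm is the spectral norm of the matrix. -/
noncomputable def matCLM {s : ℕ} (M : Matrix (Fin s) (Fin s) ℝ) :
    EuclideanSpace ℝ (Fin s) →L[ℝ] EuclideanSpace ℝ (Fin s) :=
  Matrix.toEuclideanCLM (𝕜 := ℝ) M

/-- A vector `w` on which a coercive form is bounded by `c * ‖w‖` has norm at most `c / a`. -/
theorem norm_le_div_of_mul_sq_le {V : Type*} [NormedAddCommGroup V] {a c b : ℝ} {w : V}
    (ha : 0 < a) (hc : 0 ≤ c) (hlow : a * ‖w‖ ^ 2 ≤ b) (hup : b ≤ c * ‖w‖) :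
    ‖w‖ ≤ c / a := by
  rw [le_div_iff₀ ha]
  rcases (norm_nonneg w).eq_or_lt with h | h
  · rw [← h, zero_mul]
    exact hc
  · refine le_of_mul_le_mul_right ?_ h
    calc ‖w‖ * a * ‖w‖ = a * ‖w‖ ^ 2 := by ring
      _ ≤ c * ‖w‖ := hlow.trans hup

theorem inner_apply_apply_le {V H : Type*} [NormedAddCommGroup V] [NormedSpace ℝ V]
    [NormedAddCommGroup H] [InnerProductSpace ℝ H] (G : H →L[ℝ] H) (O : V →L[ℝ] H)
    (z : H) (w : V) : ⟪z, G (O w)⟫ ≤ ‖G‖ * ‖O‖ * ‖z‖ * ‖w‖ := by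
  calc ⟪z, G (O w)⟫ ≤ ‖z‖ * ‖G (O w)‖ := real_inner_le_norm _ _
    _ ≤ ‖z‖ * (‖G‖ * (‖O‖ * ‖w‖)) := by
      gcongr
      exact G.le_opNorm_of_le (O.le_opNorm w)
    _ = ‖G‖ * ‖O‖ * ‖z‖ * ‖w‖ := by ring

/-- Differentiating the adjoint equation in the direction `e`. -/
theorem adjoint_equation_fderiv {V E H : Type*} [NormedAddCommGroup V] [NormedSpace ℝ V]
    [NormedAddCommGroup E] [NormedSpace ℝ E] [NormedAddCommGroup H] [InnerProductSpace ℝ H]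
    {A : E → V →L[ℝ] V →L[ℝ] ℝ} {u ψ : E → V} {O : V →L[ℝ] H} {G : H →L[ℝ] H} {y : H}
    {θ : E} (hA : DifferentiableAt ℝ A θ) (hu : DifferentiableAt ℝ u θ)
    (hψ : DifferentiableAt ℝ ψ θ)
    (heq : ∀ᶠ t in nhds θ, ∀ w, A t w (ψ t) = ⟪y - O (u t), G (O w)⟫) (e : E) (w : V) :
    A θ w (fderiv ℝ ψ θ e) + fderiv ℝ A θ e w (ψ θ) = -⟪O (fderiv ℝ u θ e), G (O w)⟫ := by
  have hleft := (hA.hasFDerivAt.clm_apply (hasFDerivAt_const w θ)).clm_apply hψ.hasFDerivAt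
  have hright := ((O.hasFDerivAt.comp θ hu.hasFDerivAt).const_sub y).inner ℝ
    (hasFDerivAt_const (G (O w)) θ)
  have hev : (fun t => A t w (ψ t)) =ᶠ[nhds θ] fun t => ⟪y - O (u t), G (O w)⟫ :=
    heq.mono fun t ht => ht w
  have h := DFunLike.congr_fun (hleft.unique (hright.congr_of_eventuallyEq hev)) e
  simpa using h

/-- **Stability of the parameter sensitivities of the adjoint.**
With a differentiable family of coercive bilinear forms `A(·,·;θ)`, right-hand sides
`F(·;θ)`, observation operator `O`, data `y` and noise precision matrix `Γ⁻¹`, if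
`u, ψ : Θ → V` are differentiable with `A(u(θ),v;θ) = F(v;θ)` and
`A(w,ψ(θ);θ) = (y − O(u(θ)))ᵀ Γ⁻¹ O(w)` for all `θ ∈ Θ`, then
`∑_j ‖∂_{θ_j} ψ(θ)‖ ≤ (C_ψ(θ)/α(θ)) ∑_j ρ_j(θ) + d C_y/α(θ) + (C_O/α(θ)) ∑_j ‖∂_{θ_j} u(θ)‖`,
where `C_u(θ) = ‖F(·;θ)‖/α(θ)`, `C_ψ(θ) = C_y/α(θ) + (C_O/α(θ)) C_u(θ)`,
`C_y = ‖Γ⁻¹‖₂‖O‖‖y‖₂` and `C_O = ‖Γ⁻¹‖₂‖O‖²`. -/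
theorem adjoint_sensitivity_bound
    {V : Type*} [NormedAddCommGroup V] [InnerProductSpace ℝ V] [CompleteSpace V]
    {d s : ℕ} (Θ : Set (EuclideanSpace ℝ (Fin d))) (hΘ : IsOpen Θ)
    (A : EuclideanSpace ℝ (Fin d) → V →L[ℝ] V →L[ℝ] ℝ)
    (F : EuclideanSpace ℝ (Fin d) → V →L[ℝ] ℝ)
    (α : EuclideanSpace ℝ (Fin d) → ℝ)
    (ρ : Fin d → EuclideanSpace ℝ (Fin d) → ℝ)
    (hA : ∀ θ ∈ Θ, DifferentiableAt ℝ A θ)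
    (hF : ∀ θ ∈ Θ, DifferentiableAt ℝ F θ)
    (hα : ∀ θ ∈ Θ, 0 < α θ)
    (hcoer : ∀ θ ∈ Θ, ∀ w : V, α θ * ‖w‖ ^ 2 ≤ A θ w w)
    (hρ : ∀ θ ∈ Θ, ∀ j : Fin d, ∀ w v : V,
      fderiv ℝ A θ (EuclideanSpace.single j (1 : ℝ)) w v ≤ ρ j θ * ‖w‖ * ‖v‖)
    (O : V →L[ℝ] EuclideanSpace ℝ (Fin s)) (y : EuclideanSpace ℝ (Fin s))
    (Γinv : Matrix (Fin s) (Fin s) ℝ) (hΓsymm : Γinv.IsSymm) (hΓpd : Γinv.PosDef)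
    (u ψ : EuclideanSpace ℝ (Fin d) → V)
    (hu : ∀ θ ∈ Θ, DifferentiableAt ℝ u θ)
    (hψ : ∀ θ ∈ Θ, DifferentiableAt ℝ ψ θ)
    (hequ : ∀ θ ∈ Θ, ∀ v : V, A θ (u θ) v = F θ v)
    (heqψ : ∀ θ ∈ Θ, ∀ w : V, A θ w (ψ θ) = ⟪y - O (u θ), matCLM Γinv (O w)⟫) :
    ∀ θ ∈ Θ,
      ∑ j : Fin d, ‖fderiv ℝ ψ θ (EuclideanSpace.single j (1 : ℝ))‖ ≤
        (‖matCLM Γinv‖ * ‖O‖ * ‖y‖ / α θ +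
            ‖matCLM Γinv‖ * ‖O‖ ^ 2 / α θ * (‖F θ‖ / α θ)) / α θ *
            ∑ j : Fin d, ρ j θ +
          d * (‖matCLM Γinv‖ * ‖O‖ * ‖y‖) / α θ +
          ‖matCLM Γinv‖ * ‖O‖ ^ 2 / α θ *
            ∑ j : Fin d, ‖fderiv ℝ u θ (EuclideanSpace.single j (1 : ℝ))‖ := by
  intro θ hθ
  rcases subsingleton_or_nontrivial V with hV | hV
  · have hO : O = 0 := Subsingleton.elim _ _
    have hzero : ∀ v : V, ‖v‖ = 0 := fun v => by rw [Subsingleton.elim v 0, norm_zero]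
    simp [hO, hzero]
  have ha := hα θ hθ
  set G := matCLM Γinv
  have hρ_nonneg : ∀ j, 0 ≤ ρ j θ := fun j => by
    obtain ⟨w, hw⟩ := exists_ne (0 : V)
    have h₁ := hρ θ hθ j w w
    have h₂ := hρ θ hθ j (-w) w
    simp only [map_neg, neg_apply, norm_neg] at h₂
    have hw' : 0 < ‖w‖ := norm_pos_iff.2 hw
    have h₃ : 0 ≤ ρ j θ * (‖w‖ * ‖w‖) := by linarith
    exact nonneg_of_mul_nonneg_left h₃ (by positivity)
  have hu_norm : ‖u θ‖ ≤ ‖F θ‖ / α θ :=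
    norm_le_div_of_mul_sq_le ha (norm_nonneg _) (hcoer θ hθ (u θ)) <| by
      rw [hequ θ hθ]
      exact (le_abs_self _).trans ((F θ).le_opNorm _)
  have hψ_norm : ‖ψ θ‖ ≤ ‖G‖ * ‖O‖ * ‖y‖ / α θ + ‖G‖ * ‖O‖ ^ 2 / α θ * (‖F θ‖ / α θ) := by
    have hres : ‖y - O (u θ)‖ ≤ ‖y‖ + ‖O‖ * (‖F θ‖ / α θ) :=
      (norm_sub_le _ _).trans (add_le_add_right (O.le_opNorm_of_le hu_norm) _)
    calc ‖ψ θ‖ ≤ ‖G‖ * ‖O‖ * (‖y‖ + ‖O‖ * (‖F θ‖ / α θ)) / α θ := by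
          refine norm_le_div_of_mul_sq_le ha (by positivity) (hcoer θ hθ (ψ θ)) ?_
          rw [heqψ θ hθ]
          refine (inner_apply_apply_le G O _ _).trans ?_
          gcongr
      _ = _ := by ring
  have hterm : ∀ j : Fin d, ‖fderiv ℝ ψ θ (EuclideanSpace.single j (1 : ℝ))‖ ≤
      (‖G‖ * ‖O‖ * ‖y‖ / α θ + ‖G‖ * ‖O‖ ^ 2 / α θ * (‖F θ‖ / α θ)) / α θ * ρ j θ +
        ‖G‖ * ‖O‖ ^ 2 / α θ * ‖fderiv ℝ u θ (EuclideanSpace.single j (1 : ℝ))‖ := fun j => by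
    set e := EuclideanSpace.single j (1 : ℝ)
    set p := fderiv ℝ ψ θ e
    have heq := adjoint_equation_fderiv (hA θ hθ) (hu θ hθ) (hψ θ hθ)
      (Filter.eventually_of_mem (hΘ.mem_nhds hθ) heqψ) e p
    have hA' := hρ θ hθ j (-p) (ψ θ)
    have hobs := inner_apply_apply_le G O (O (fderiv ℝ u θ e)) (-p)
    simp only [map_neg, neg_apply, norm_neg, inner_neg_right] at hA' hobs
    have hup : A θ p p ≤
        (ρ j θ * ‖ψ θ‖ + ‖G‖ * ‖O‖ * (‖O‖ * ‖fderiv ℝ u θ e‖)) * ‖p‖ := by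
      calc A θ p p ≤ ρ j θ * ‖p‖ * ‖ψ θ‖ + ‖G‖ * ‖O‖ * ‖O (fderiv ℝ u θ e)‖ * ‖p‖ := by
            linarith
        _ ≤ ρ j θ * ‖p‖ * ‖ψ θ‖ + ‖G‖ * ‖O‖ * (‖O‖ * ‖fderiv ℝ u θ e‖) * ‖p‖ := by
            gcongr
            exact O.le_opNorm _
        _ = _ := by ring
    have hj := hρ_nonneg j
    calc ‖p‖ ≤ (ρ j θ * ‖ψ θ‖ + ‖G‖ * ‖O‖ * (‖O‖ * ‖fderiv ℝ u θ e‖)) / α θ :=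
          norm_le_div_of_mul_sq_le ha (by positivity) (hcoer θ hθ p) hup
      _ ≤ (ρ j θ * (‖G‖ * ‖O‖ * ‖y‖ / α θ + ‖G‖ * ‖O‖ ^ 2 / α θ * (‖F θ‖ / α θ)) +
            ‖G‖ * ‖O‖ * (‖O‖ * ‖fderiv ℝ u θ e‖)) / α θ := by gcongr
      _ = _ := by ring
  have hsum := Finset.sum_le_sum fun j (_ : j ∈ Finset.univ) => hterm j
  rw [Finset.sum_add_distrib, ← Finset.mul_sum, ← Finset.mul_sum] at hsum
  have hdata : 0 ≤ d * (‖G‖ * ‖O‖ * ‖y‖) / α θ := by positivity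
  linarith
end

section
/- Let V_h be a subspace of V. Suppose u_h ∈ V_h satisfies A(u_h, v) = F(v) for all v ∈ V_h, ψ_h ∈ V_h satisfies A(w, ψ_h) = (y − O(u_h))ᵀ Γ⁻¹ O(w) for all w ∈ V_h, and let u_r, ψ_r ∈ V_h be arbitrary. Set e_u = u_h − u_r, e_ψ = ψ_h − ψ_r, and Δ = A(u_r, ψ_r) − F(ψ_r). Then the exact identity η(u_h) − η(u_r) − Δ = −A(e_u, e_ψ) − (1/2) (O(e_u))ᵀ Γ⁻¹ O(e_u) holds. -/
open scoped RealInnerProductSpace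

/-- The potential `η(u) = (1/2)(y − O(u))ᵀ Γ⁻¹ (y − O(u))`. -/
noncomputable def potential {V : Type*} [NormedAddCommGroup V] [InnerProductSpace ℝ V]
    {s : ℕ} (O : V →L[ℝ] EuclideanSpace ℝ (Fin s)) (y : EuclideanSpace ℝ (Fin s))
    (Γinv : Matrix (Fin s) (Fin s) ℝ) (u : V) : ℝ :=
  (1 / 2) * ⟪y - O u, matCLM Γinv (y - O u)⟫

/-- The operator of a symmetric matrix is symmetric for the Euclidean inner product. -/
theorem inner_matCLM_comm {s : ℕ} {M : Matrix (Fin s) (Fin s) ℝ} (hM : M.IsSymm)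
    (a b : EuclideanSpace ℝ (Fin s)) : ⟪a, matCLM M b⟫ = ⟪b, matCLM M a⟫ := by
  have hstar : star (matCLM M) = matCLM M := by
    rw [matCLM, ← map_star, Matrix.star_eq_conjTranspose,
      Matrix.conjTranspose_eq_transpose_of_trivial, hM.eq]
  rw [← ContinuousLinearMap.adjoint_inner_left, ← ContinuousLinearMap.star_eq_adjoint, hstar,
    real_inner_comm]

/-- **Exact identity for the dual-weighted-residual error.**
Let `V_h ⊆ V` be a subspace, `u_h ∈ V_h` Galerkin state, `ψ_h ∈ V_h` Galerkin adjoint,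
and `u_r, ψ_r ∈ V_h` arbitrary. With `e_u = u_h − u_r`, `e_ψ = ψ_h − ψ_r` and
`Δ = A(u_r, ψ_r) − F(ψ_r)`, the exact identity
`η(u_h) − η(u_r) − Δ = −A(e_u, e_ψ) − (1/2)(O e_u)ᵀ Γ⁻¹ (O e_u)` holds. -/
theorem dwr_potential_error_identity
    {V : Type*} [NormedAddCommGroup V] [InnerProductSpace ℝ V] [CompleteSpace V]
    {s : ℕ}
    (A : V →ₗ[ℝ] V →ₗ[ℝ] ℝ) (F : V →L[ℝ] ℝ)
    (O : V →L[ℝ] EuclideanSpace ℝ (Fin s)) (y : EuclideanSpace ℝ (Fin s))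
    (Γinv : Matrix (Fin s) (Fin s) ℝ) (hΓsymm : Γinv.IsSymm) (hΓpd : Γinv.PosDef)
    (Vh : Submodule ℝ V) (uh ψh ur ψr : V)
    (huh : uh ∈ Vh) (hψh : ψh ∈ Vh) (hur : ur ∈ Vh) (hψr : ψr ∈ Vh)
    (hstate : ∀ v ∈ Vh, A uh v = F v)
    (hadjoint : ∀ w ∈ Vh, A w ψh = ⟪y - O uh, matCLM Γinv (O w)⟫) :
    potential O y Γinv uh - potential O y Γinv ur - (A ur ψr - F ψr) =
      -A (uh - ur) (ψh - ψr) -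
        (1 / 2) * ⟪O (uh - ur), matCLM Γinv (O (uh - ur))⟫ := by
  have hsub : y - O ur = (y - O uh) + O (uh - ur) := by
    rw [map_sub]
    abel
  have hadj := hadjoint (uh - ur) (Vh.sub_mem huh hur)
  have hcomm := inner_matCLM_comm hΓsymm (O (uh - ur)) (y - O uh)
  have hA : A (uh - ur) ψr = F ψr - A ur ψr := by
    rw [map_sub, LinearMap.sub_apply, hstate ψr hψr]
  rw [potential, potential, hsub, map_sub (A (uh - ur)), hA, hadj]
  simp only [map_add, inner_add_left, inner_add_right]
  linarith
end

section
/- Let V_h be a subspace of V, and let u_h, u_r ∈ V_h. Suppose u_h' ∈ V_h satisfies the sensitivity equation A(u_h', v) + B(u_h, v) = G(v) for all v ∈ V_h, and let u_r' ∈ V_h be arbitrary. Define the sensitivity residual dual norm ‖R'‖ = sup { |A(u_r', v) + B(u_r, v) − G(v)| : v ∈ V_h, ‖v‖_V ≤ 1 }. Then ‖u_h' − u_r'‖_V ≤ ‖R'‖ / α + (ρ/α) ‖u_h − u_r‖_V. -/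
/-- A continuous functional is bounded on a subspace by its dual norm over that subspace. -/
theorem ContinuousLinearMap.abs_apply_le_sSup_mul_norm
    {V : Type*} [NormedAddCommGroup V] [NormedSpace ℝ V]
    (f : V →L[ℝ] ℝ) (W : Submodule ℝ V) {v : V} (hv : v ∈ W) :
    |f v| ≤ sSup {r : ℝ | ∃ w ∈ W, ‖w‖ ≤ 1 ∧ r = |f w|} * ‖v‖ := by
  have hbdd : BddAbove {r : ℝ | ∃ w ∈ W, ‖w‖ ≤ 1 ∧ r = |f w|} := by
    refine ⟨‖f‖, ?_⟩
    rintro r ⟨w, -, hw, rfl⟩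
    exact f.unit_le_opNorm w hw
  rcases eq_or_ne v 0 with rfl | hv0
  · simp
  have hpos : 0 < ‖v‖ := norm_pos_iff.mpr hv0
  rw [← div_le_iff₀ hpos]
  refine le_csSup hbdd ⟨‖v‖⁻¹ • v, W.smul_mem _ hv, ?_, ?_⟩
  · rw [norm_smul, norm_inv, norm_norm, inv_mul_cancel₀ hpos.ne']
  · rw [map_smul, smul_eq_mul, abs_mul, abs_of_pos (inv_pos.mpr hpos), div_eq_inv_mul]

/-- **A-posteriori error bound for the reduced state sensitivity.**
Let `V_h ⊆ V` be a subspace, `u_h, u_r ∈ V_h`, and suppose `u_h' ∈ V_h` satisfies the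
sensitivity equation `A(u_h', v) + B(u_h, v) = G(v)` for all `v ∈ V_h`, with
`u_r' ∈ V_h` arbitrary. With the sensitivity residual dual norm
`‖R'‖ = sup { |A(u_r', v) + B(u_r, v) − G(v)| : v ∈ V_h, ‖v‖ ≤ 1 }`, one has
`‖u_h' − u_r'‖ ≤ ‖R'‖/α + (ρ/α)‖u_h − u_r‖`. -/
theorem state_sensitivity_residual_bound
    {V : Type*} [NormedAddCommGroup V] [InnerProductSpace ℝ V] [CompleteSpace V]
    (A B : V →L[ℝ] V →L[ℝ] ℝ) (G : V →L[ℝ] ℝ)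
    (α ρ : ℝ) (hα : 0 < α) (hρ : 0 < ρ)
    (hcoer : ∀ w : V, α * ‖w‖ ^ 2 ≤ A w w)
    (hB : ∀ w v : V, B w v ≤ ρ * ‖w‖ * ‖v‖)
    (Vh : Submodule ℝ V) (uh ur uh' ur' : V)
    (huh : uh ∈ Vh) (hur : ur ∈ Vh) (huh' : uh' ∈ Vh) (hur' : ur' ∈ Vh)
    (hsens : ∀ v ∈ Vh, A uh' v + B uh v = G v)
    (Rnorm : ℝ)
    (hR : Rnorm = sSup {r : ℝ | ∃ v ∈ Vh, ‖v‖ ≤ 1 ∧ r = |A ur' v + B ur v - G v|}) :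
    ‖uh' - ur'‖ ≤ Rnorm / α + ρ / α * ‖uh - ur‖ := by
  have he : uh' - ur' ∈ Vh := Vh.sub_mem huh' hur'
  have hres : |A ur' (uh' - ur') + B ur (uh' - ur') - G (uh' - ur')|
      ≤ Rnorm * ‖uh' - ur'‖ :=
    hR ▸ (A ur' + B ur - G).abs_apply_le_sSup_mul_norm Vh he
  have hRnn : 0 ≤ Rnorm := by
    rw [hR]
    refine Real.sSup_nonneg ?_
    rintro r ⟨v, -, -, rfl⟩
    exact abs_nonneg _
  have hc := hcoer (uh' - ur')
  have hb := hB (ur - uh) (uh' - ur')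
  rw [norm_sub_rev ur uh] at hb
  have hs := hsens _ he
  have hid : A (uh' - ur') (uh' - ur') = A uh' (uh' - ur') - A ur' (uh' - ur') := by
    rw [map_sub A, sub_apply]
  rw [map_sub B, sub_apply] at hb
  have hmul : α * ‖uh' - ur'‖ * ‖uh' - ur'‖
      ≤ (Rnorm + ρ * ‖uh - ur‖) * ‖uh' - ur'‖ := by
    linarith [neg_le_of_abs_le hres]
  have hle : α * ‖uh' - ur'‖ ≤ Rnorm + ρ * ‖uh - ur‖ := by
    rcases (norm_nonneg (uh' - ur')).eq_or_lt with h0 | hpos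
    · rw [← h0, mul_zero]
      positivity
    · exact le_of_mul_le_mul_right hmul hpos
  rw [div_mul_eq_mul_div, ← add_div, le_div_iff₀ hα, mul_comm]
  exact hle
end
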